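/- A von Neumann algebra M is a factor (i.e., its center Z(M) = M ∩ M' consists of scalar multiples of the identity) if and only if the preorder ≼ on projections of M is total: for all projections p, q ∈ M, either p ≼ q or q ≼ p. -/

import Mathlib

variable {H : Type*} [NormedAddCommGroup H] [InnerProductSpace ℂ H] [CompleteSpace H]

/-- A projection in `B(H)`: an idempotent self-adjoint operator. -/
def IsProjection (p : H →L[ℂ] H) : Prop :=
  IsIdempotentElem p ∧ IsSelfAdjoint p

/-- Murray–von Neumann equivalence of `p` and `q` relative to a von Neumann algebra `M`:
there is a partial isometry `u ∈ M` with `u* u = p` and `u u* = q`. -/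
def MvNEquiv (M : VonNeumannAlgebra H) (p q : H →L[ℂ] H) : Prop :=
  ∃ u ∈ M, ContinuousLinearMap.adjoint u * u = p ∧ u * ContinuousLinearMap.adjoint u = q

/-- `p ≼ q` relative to `M`: `p` is Murray–von Neumann equivalent to a subprojection of `q`
(`p' ≤ q`, i.e. `ran p' ⊆ ran q`, expressed as `q * p' = p'`). -/
def Subordinate (M : VonNeumannAlgebra H) (p q : H →L[ℂ] H) : Prop :=
  ∃ p' : H →L[ℂ] H, p' ∈ M ∧ IsProjection p' ∧ q * p' = p' ∧ MvNEquiv M p p'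

open ContinuousLinearMap in
/-- An isometric graph extends to a partial isometry. -/
theorem graph_extend (G : Submodule ℂ (H × H)) (hG : ∀ g ∈ G, ‖g.1‖ = ‖g.2‖)
    (K : Submodule ℂ H) [CompleteSpace K]
    (hK : K = (G.map (LinearMap.fst ℂ H H)).topologicalClosure) :
    ∃ V : H →L[ℂ] H, (∀ g ∈ G, V g.1 = g.2) ∧ V * K.starProjection = V ∧
      adjoint V * V = K.starProjection := by
  have hmem : ∀ g : G, (LinearMap.fst ℂ H H ∘ₗ G.subtype) g ∈ K := by
    intro g
    rw [hK]
    exact Submodule.le_topologicalClosure _ ⟨g, g.2, rfl⟩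
  let e : G →ₗ[ℂ] K := (LinearMap.fst ℂ H H ∘ₗ G.subtype).codRestrict K hmem
  let f : G →ₗ[ℂ] H := LinearMap.snd ℂ H H ∘ₗ G.subtype
  have hd : DenseRange e := by
    intro x
    rw [closure_subtype]
    have hx : (x : H) ∈ (G.map (LinearMap.fst ℂ H H)).topologicalClosure := hK.le x.2
    refine closure_mono ?_ hx
    rintro _ ⟨g, hg, rfl⟩
    exact ⟨e ⟨g, hg⟩, ⟨_, rfl⟩, rfl⟩
  have hn : ∀ x, ‖f x‖ = ‖e x‖ := fun x => (hG x.1 x.2).symm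
  let V0 : K →L[ℂ] H := f.extendOfNorm e
  have hV0 : ∀ g, V0 (e g) = f g :=
    LinearMap.extendOfNorm_eq hd ⟨1, fun x => by rw [one_mul, hn]⟩
  have hiso : ∀ x, ‖V0 x‖ = ‖x‖ := by
    refine hd.induction ?_ (isClosed_eq (by fun_prop) (by fun_prop))
    rintro _ ⟨g, rfl⟩
    rw [hV0, hn]
  refine ⟨V0 ∘L K.orthogonalProjectionOnto, ?_, ?_, ?_⟩
  · intro g hg
    have h1 : K.orthogonalProjectionOnto g.1 = e ⟨g, hg⟩ :=
      Submodule.orthogonalProjectionOnto_mem_subspace_eq_self (e ⟨g, hg⟩)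
    rw [comp_apply, h1, hV0]
    rfl
  · ext x
    have h1 : K.orthogonalProjectionOnto (K.starProjection x) = K.orthogonalProjectionOnto x :=
      Submodule.orthogonalProjectionOnto_mem_subspace_eq_self (K.orthogonalProjectionOnto x)
    exact congrArg V0 h1
  · have : ((adjoint (V0 ∘L K.orthogonalProjectionOnto) * (V0 ∘L K.orthogonalProjectionOnto) :
        H →L[ℂ] H) : H →ₗ[ℂ] H) = (K.starProjection : H →ₗ[ℂ] H) := by
      rw [← ext_inner_map]
      intro x
      have h2 := K.starProjection_inner_eq_zero x (K.starProjection x)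
        (K.starProjection_apply_mem x)
      rw [inner_sub_left, sub_eq_zero] at h2
      have h3 : inner ℂ (K.starProjection x) x =
          inner ℂ (K.starProjection x) (K.starProjection x) := by
        rw [← inner_conj_symm, h2, inner_conj_symm]
      refine Eq.trans (adjoint_inner_left (V0 ∘L K.orthogonalProjectionOnto) _ _) ?_
      refine Eq.trans ?_ h3.symm
      change inner ℂ (V0 (K.orthogonalProjectionOnto x)) (V0 (K.orthogonalProjectionOnto x)) = _
      rw [inner_self_eq_norm_sq_to_K, inner_self_eq_norm_sq_to_K, hiso]
      rfl
    ext x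
    exact congrArg (fun L : H →ₗ[ℂ] H => L x) this

theorem starProjection_mem (M : VonNeumannAlgebra H) (K : Submodule ℂ H)
    [K.HasOrthogonalProjection]
    (h : ∀ y ∈ M.commutant, ∀ x ∈ K, y x ∈ K) : K.starProjection ∈ M := by
  rw [VonNeumannAlgebra.IsStarProjection.mem_iff isStarProjection_starProjection]
  intro y hy x hx
  rw [Submodule.range_starProjection] at hx ⊢
  exact h y hy x hx

theorem mem_of_commutes (M : VonNeumannAlgebra H) (V : H →L[ℂ] H)
    (h : ∀ y ∈ M.commutant, y * V = V * y) : V ∈ M := by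
  rw [← VonNeumannAlgebra.commutant_commutant M, VonNeumannAlgebra.mem_commutant_iff]
  exact h

/-- The set of isometric `M'`-invariant graphs. -/
def InvGraph (M : VonNeumannAlgebra H) (p q : H →L[ℂ] H) (G : Submodule ℂ (H × H)) : Prop :=
  (∀ g ∈ G, ‖g.1‖ = ‖g.2‖) ∧ (∀ g ∈ G, p g.1 = g.1) ∧ (∀ g ∈ G, q g.2 = g.2) ∧
    ∀ y ∈ M.commutant, ∀ g ∈ G, (y g.1, y g.2) ∈ G

theorem InvGraph.swap {M : VonNeumannAlgebra H} {p q : H →L[ℂ] H} {G : Submodule ℂ (H × H)}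
    (h : InvGraph M p q G) :
    InvGraph M q p (G.comap (LinearEquiv.prodComm ℂ H H : H × H →ₗ[ℂ] H × H)) := by
  obtain ⟨h1, h2, h3, h4⟩ := h
  refine ⟨?_, ?_, ?_, ?_⟩
  · intro g hg; exact (h1 _ hg).symm
  · intro g hg; exact h3 _ hg
  · intro g hg; exact h2 _ hg
  · intro y hy g hg; exact h4 y hy _ hg

/-- Closure of the first-coordinate projection of a graph. -/
def domK (G : Submodule ℂ (H × H)) : Submodule ℂ H :=
  (G.map (LinearMap.fst ℂ H H)).topologicalClosure

instance (G : Submodule ℂ (H × H)) : CompleteSpace (domK G) :=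
  (Submodule.isClosed_topologicalClosure _).completeSpace_coe

theorem domK_closed (G : Submodule ℂ (H × H)) : IsClosed (domK G : Set H) :=
  Submodule.isClosed_topologicalClosure _

theorem mem_domK {G : Submodule ℂ (H × H)} {g : H × H} (hg : g ∈ G) : g.1 ∈ domK G :=
  Submodule.le_topologicalClosure _ ⟨g, hg, rfl⟩

theorem domK_le {G : Submodule ℂ (H × H)} {P : H → Prop} (hP : IsClosed {x | P x})
    (h : ∀ g ∈ G, P g.1) : ∀ x ∈ domK G, P x := by
  intro x hx
  refine closure_minimal ?_ hP hx
  rintro _ ⟨g, hg, rfl⟩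
  exact h g hg

theorem InvGraph.proj_mem {M : VonNeumannAlgebra H} {p q : H →L[ℂ] H} {G : Submodule ℂ (H × H)}
    (h : InvGraph M p q G) : (domK G).starProjection ∈ M := by
  apply starProjection_mem
  intro y hy
  refine domK_le ((domK_closed G).preimage y.continuous) ?_
  intro g hg
  exact mem_domK (h.2.2.2 y hy g hg)

theorem InvGraph.mul_proj {M : VonNeumannAlgebra H} {p q : H →L[ℂ] H} {G : Submodule ℂ (H × H)}
    (h : InvGraph M p q G) : p * (domK G).starProjection = (domK G).starProjection := by
  ext x
  exact domK_le (P := fun x => p x = x) (isClosed_eq p.continuous continuous_id) h.2.1 _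
    (Submodule.starProjection_apply_mem _ _)

open ContinuousLinearMap in
theorem InvGraph.subordinate {M : VonNeumannAlgebra H} {p q : H →L[ℂ] H}
    {G : Submodule ℂ (H × H)}
    (h : InvGraph M p q G) (hp : (domK G).starProjection = p) : Subordinate M p q := by
  have hproj := h.proj_mem
  obtain ⟨V, hV, hVK, hVV⟩ := graph_extend G h.1 (domK G) rfl
  have hVM : V ∈ M := by
    apply mem_of_commutes
    intro y hy
    have hc : (domK G).starProjection * y = y * (domK G).starProjection :=
      VonNeumannAlgebra.mem_commutant_iff.1 hy _ hproj
    have key : ∀ x ∈ domK G, y (V x) = V (y x) := by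
      refine domK_le (isClosed_eq (by fun_prop) (by fun_prop)) ?_
      intro g hg
      rw [hV g hg, hV _ (h.2.2.2 y hy g hg)]
    calc y * V = y * (V * (domK G).starProjection) := by rw [hVK]
      _ = V * (y * (domK G).starProjection) := by
        ext x
        exact key _ (Submodule.starProjection_apply_mem _ _)
      _ = V * y := by rw [← hc, ← mul_assoc, hVK]
  have hqV : q * V = V := by
    have key : ∀ x ∈ domK G, q (V x) = V x := by
      refine domK_le (isClosed_eq (by fun_prop) (by fun_prop)) ?_
      intro g hg
      rw [hV g hg, h.2.2.1 g hg]
    rw [← hVK]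
    ext x
    exact key _ (Submodule.starProjection_apply_mem _ _)
  refine ⟨V * adjoint V, mul_mem hVM (star_mem hVM), ⟨?_, ?_⟩, ?_, V, hVM, ?_, rfl⟩
  · show V * adjoint V * (V * adjoint V) = V * adjoint V
    rw [mul_assoc, ← mul_assoc (adjoint V), hVV, ← mul_assoc, hVK]
  · exact IsSelfAdjoint.mul_star_self V
  · rw [← mul_assoc, hqV]
  · rw [hVV, hp]

/-- In a factor, a closed subspace invariant under `M` and `M'` is trivial. -/
theorem factor_invariant (M : VonNeumannAlgebra H)
    (hM : ∀ T ∈ M, (∀ S ∈ M, T * S = S * T) → ∃ c : ℂ, T = c • (1 : H →L[ℂ] H))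
    (K : Submodule ℂ H) [K.HasOrthogonalProjection]
    (h1 : ∀ y ∈ M.commutant, ∀ x ∈ K, y x ∈ K) (h2 : ∀ y ∈ M, ∀ x ∈ K, y x ∈ K) :
    (∀ x ∈ K, x = 0) ∨ ∀ x, x ∈ K := by
  have a1 := starProjection_mem M K h1
  have a2 := starProjection_mem M.commutant K (by rwa [VonNeumannAlgebra.commutant_commutant])
  rw [VonNeumannAlgebra.mem_commutant_iff] at a2
  obtain ⟨c, hc⟩ := hM _ a1 (fun S hS => (a2 S hS).symm)
  by_cases h0 : c = 0
  · left
    intro x hx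
    rw [← Submodule.starProjection_eq_self_iff.2 hx, hc, h0]
    simp
  · right
    intro x
    have : K.starProjection (c⁻¹ • x) = x := by
      rw [hc]; simp [h0]
    rw [← this]
    exact Submodule.starProjection_apply_mem _ _

theorem factor_mul_eq_zero (M : VonNeumannAlgebra H)
    (hM : ∀ T ∈ M, (∀ S ∈ M, T * S = S * T) → ∃ c : ℂ, T = c • (1 : H →L[ℂ] H))
    (p q : H →L[ℂ] H) (hq : q ∈ M) (h : ∀ x ∈ M, q * x * p = 0) : p = 0 ∨ q = 0 := by
  let K : Submodule ℂ H := ⨅ x : M, (q * x.1).ker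
  have hK : ∀ v, v ∈ K ↔ ∀ x ∈ M, q (x v) = 0 := by
    intro v
    simp [K, Submodule.mem_iInf]
  have hcl : IsClosed (K : Set H) := by
    have : (K : Set H) = ⋂ x : M, {v | q (x.1 v) = 0} := by
      ext v
      simp [hK]
    rw [this]
    exact isClosed_iInter fun x => isClosed_eq (by fun_prop) continuous_const
  haveI : CompleteSpace K := hcl.completeSpace_coe
  have inv1 : ∀ y ∈ M.commutant, ∀ x ∈ K, y x ∈ K := by
    intro y hy v hv
    rw [hK] at hv ⊢
    intro x hx
    have := VonNeumannAlgebra.mem_commutant_iff.1 hy (q * x) (mul_mem hq hx)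
    have := congrArg (fun L : H →L[ℂ] H => L v) this
    simp only [ContinuousLinearMap.mul_apply] at this
    rw [this, hv x hx, map_zero]
  have inv2 : ∀ y ∈ M, ∀ x ∈ K, y x ∈ K := by
    intro y hy v hv
    rw [hK] at hv ⊢
    intro x hx
    exact hv (x * y) (mul_mem hx hy)
  rcases factor_invariant M hM K inv1 inv2 with h0 | h0
  · left
    ext v
    refine h0 _ ((hK _).2 ?_)
    intro x hx
    exact congrArg (fun L : H →L[ℂ] H => L v) (h x hx)
  · right
    ext v
    exact (hK v).1 (h0 v) 1 (one_mem M)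

theorem exists_maximal_graph (M : VonNeumannAlgebra H) (p q : H →L[ℂ] H) :
    ∃ G, Maximal (fun G => G ∈ {G | InvGraph M p q G}) G := by
  refine (zorn_le_nonempty₀ {G | InvGraph M p q G} ?_ ⊥ ?_).imp fun _ h => h.2
  · intro c hc hch G0 hG0
    have hdir : DirectedOn (· ≤ ·) c := hch.directedOn
    have hm : ∀ g, g ∈ sSup c ↔ ∃ G ∈ c, g ∈ G := fun g =>
      Submodule.mem_sSup_of_directed ⟨G0, hG0⟩ hdir
    refine ⟨sSup c, ⟨?_, ?_, ?_, ?_⟩, fun z hz => le_sSup hz⟩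
    · intro g hg
      obtain ⟨G, hG, hg⟩ := (hm g).1 hg
      exact (hc hG).1 g hg
    · intro g hg
      obtain ⟨G, hG, hg⟩ := (hm g).1 hg
      exact (hc hG).2.1 g hg
    · intro g hg
      obtain ⟨G, hG, hg⟩ := (hm g).1 hg
      exact (hc hG).2.2.1 g hg
    · intro y hy g hg
      obtain ⟨G, hG, hg⟩ := (hm g).1 hg
      exact (hm _).2 ⟨G, hG, (hc hG).2.2.2 y hy g hg⟩
  · refine ⟨?_, ?_, ?_, ?_⟩
    · rintro g rfl; simp
    · rintro g rfl; simp
    · rintro g rfl; simp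
    · rintro y - g rfl; simp

theorem norm_abs_apply (y : H →L[ℂ] H) (h : H) : ‖CFC.abs y h‖ = ‖y h‖ := by
  have hsa : star (CFC.abs y) = CFC.abs y := (CFC.abs_nonneg y).isSelfAdjoint
  have h1 : star (CFC.abs y) * CFC.abs y = star y * y := by
    rw [hsa, CFC.abs_mul_abs]
  have h2 : ∀ A : H →L[ℂ] H, ‖A h‖ ^ 2 = RCLike.re (inner ℂ ((star A * A) h) h) := by
    intro A
    rw [ContinuousLinearMap.star_eq_adjoint]
    exact ContinuousLinearMap.apply_norm_sq_eq_inner_adjoint_left A h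
  have h3 : ‖CFC.abs y h‖ ^ 2 = ‖y h‖ ^ 2 := by rw [h2, h2, h1]
  exact (sq_eq_sq₀ (norm_nonneg _) (norm_nonneg _)).1 h3

/-- A self-adjoint `r` killing `a` and fixing `b` makes them orthogonal. -/
theorem inner_zero_of {r : H →L[ℂ] H} (hr : IsSelfAdjoint r) {a b : H} (ha : r a = 0)
    (hb : r b = b) : inner ℂ a b = 0 := by
  rw [← hb, ← ContinuousLinearMap.adjoint_inner_left, ← ContinuousLinearMap.star_eq_adjoint,
    hr.star_eq, ha, inner_zero_left]

theorem sub_proj {p e : H →L[ℂ] H} (hp : IsProjection p) (he : IsStarProjection e)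
    (hpe : p * e = e) : IsProjection (p - e) := by
  have hep : e * p = e := by
    have := congrArg star hpe
    rwa [star_mul, he.isSelfAdjoint.star_eq, hp.2.star_eq] at this
  refine ⟨?_, hp.2.sub he.isSelfAdjoint⟩
  show (p - e) * (p - e) = p - e
  have h1 : p * p = p := hp.1
  have h2 : e * e = e := he.isIdempotentElem
  rw [sub_mul, mul_sub, mul_sub, h1, hpe, hep, h2]; abel

theorem comparison (M : VonNeumannAlgebra H)
    (hM : ∀ T ∈ M, (∀ S ∈ M, T * S = S * T) → ∃ c : ℂ, T = c • (1 : H →L[ℂ] H))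
    (p q : H →L[ℂ] H) (hp : p ∈ M) (hq : q ∈ M) (hpp : IsProjection p) (hqp : IsProjection q) :
    Subordinate M p q ∨ Subordinate M q p := by
  obtain ⟨G, hG, hmax⟩ := exists_maximal_graph M p q
  replace hG : InvGraph M p q G := hG
  have hG' := hG.swap
  set G' := G.comap (LinearEquiv.prodComm ℂ H H : H × H →ₗ[ℂ] H × H) with hG'def
  set P := (domK G).starProjection with hP
  set Q := (domK G').starProjection with hQ
  have hPs : IsStarProjection P := isStarProjection_starProjection
  have hQs : IsStarProjection Q := isStarProjection_starProjection
  have hp1 : IsProjection (p - P) := sub_proj hpp hPs hG.mul_proj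
  have hq1 : IsProjection (q - Q) := sub_proj hqp hQs hG'.mul_proj
  have hp1M : p - P ∈ M := sub_mem hp hG.proj_mem
  have hq1M : q - Q ∈ M := sub_mem hq hG'.proj_mem
  have hp1G : ∀ g ∈ G, (p - P) g.1 = 0 := by
    intro g hg
    have : P g.1 = g.1 := Submodule.starProjection_eq_self_iff.2 (mem_domK hg)
    rw [ContinuousLinearMap.sub_apply, this, hG.2.1 g hg, sub_self]
  have hq1G : ∀ g ∈ G, (q - Q) g.2 = 0 := by
    intro g hg
    have h1 : g.swap ∈ G' := hg
    have : Q g.2 = g.2 := Submodule.starProjection_eq_self_iff.2 (mem_domK h1)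
    rw [ContinuousLinearMap.sub_apply, this, hG.2.2.1 g hg, sub_self]
  have hpp1 : p * (p - P) = p - P := by
    rw [mul_sub, hG.mul_proj]; congr 1; exact hpp.1
  have hqq1 : q * (q - Q) = q - Q := by
    rw [mul_sub, hG'.mul_proj]; congr 1; exact hqp.1
  have key : ∀ x ∈ M, (q - Q) * x * (p - P) = 0 := by
    intro x hx
    set y := (q - Q) * x * (p - P) with hy
    have hyM : y ∈ M := mul_mem (mul_mem hq1M hx) hp1M
    have hqy : (q - Q) * y = y := by
      rw [hy, ← mul_assoc, ← mul_assoc]; congr 2; exact hq1.1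
    have hyp : y * (p - P) = y := by
      rw [hy, mul_assoc]; congr 1; exact hp1.1
    have hsa : star (CFC.abs y) = CFC.abs y := (CFC.abs_nonneg y).isSelfAdjoint
    have hap : CFC.abs y * (p - P) = CFC.abs y := by
      ext h
      rw [← sub_eq_zero, ContinuousLinearMap.mul_apply, ← map_sub, ← norm_eq_zero,
        norm_abs_apply, map_sub, ← ContinuousLinearMap.mul_apply, hyp, sub_self, norm_zero]
    have hpa : (p - P) * CFC.abs y = CFC.abs y := by
      have := congrArg star hap
      rwa [star_mul, hsa, hp1.2.star_eq] at this
    let L : H →ₗ[ℂ] H × H := LinearMap.prod (CFC.abs y : H →L[ℂ] H).toLinearMap y.toLinearMap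
    have hL : InvGraph M p q (G ⊔ LinearMap.range L) := by
      have hdec : ∀ g ∈ G ⊔ LinearMap.range L, ∃ g0 ∈ G, ∃ h,
          g = (g0.1 + CFC.abs y h, g0.2 + y h) := by
        intro g hg
        obtain ⟨g0, hg0, _, ⟨h, rfl⟩, rfl⟩ := Submodule.mem_sup.1 hg
        exact ⟨g0, hg0, h, rfl⟩
      have fixp : ∀ h, (p - P) (CFC.abs y h) = CFC.abs y h := fun h =>
        congrArg (fun L : H →L[ℂ] H => L h) hpa
      have fixq : ∀ h, (q - Q) (y h) = y h := fun h =>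
        congrArg (fun L : H →L[ℂ] H => L h) hqy
      have fixp' : ∀ v, (p - P) v = v → p v = v := fun v hv => by
        have := congrArg (fun L : H →L[ℂ] H => L v) hpp1
        simp only [ContinuousLinearMap.mul_apply] at this
        rwa [hv] at this
      have fixq' : ∀ v, (q - Q) v = v → q v = v := fun v hv => by
        have := congrArg (fun L : H →L[ℂ] H => L v) hqq1
        simp only [ContinuousLinearMap.mul_apply] at this
        rwa [hv] at this
      refine ⟨?_, ?_, ?_, ?_⟩
      · intro g hg
        obtain ⟨g0, hg0, h, rfl⟩ := hdec g hg
        have o1 := inner_zero_of hp1.2 (hp1G g0 hg0) (fixp h)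
        have o2 := inner_zero_of hq1.2 (hq1G g0 hg0) (fixq h)
        have n1 := norm_add_sq_eq_norm_sq_add_norm_sq_of_inner_eq_zero _ _ o1
        have n2 := norm_add_sq_eq_norm_sq_add_norm_sq_of_inner_eq_zero _ _ o2
        rw [hG.1 g0 hg0, norm_abs_apply, ← n2] at n1
        exact (mul_self_inj (norm_nonneg _) (norm_nonneg _)).1 n1
      · intro g hg
        obtain ⟨g0, hg0, h, rfl⟩ := hdec g hg
        simp only [map_add]
        rw [hG.2.1 g0 hg0, fixp' _ (fixp h)]
      · intro g hg
        obtain ⟨g0, hg0, h, rfl⟩ := hdec g hg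
        simp only [map_add]
        rw [hG.2.2.1 g0 hg0, fixq' _ (fixq h)]
      · intro z hz g hg
        obtain ⟨g0, hg0, h, rfl⟩ := hdec g hg
        have hz' := VonNeumannAlgebra.mem_commutant_iff.1 hz
        have c1 : Commute z y := (hz' y hyM).symm
        have c2 : Commute y (star z) :=
          VonNeumannAlgebra.mem_commutant_iff.1 (star_mem hz) y hyM
        have c3 : Commute z (CFC.abs y) := (c1.symm.cfcAbs_left c2).symm
        refine Submodule.mem_sup.2 ⟨(z g0.1, z g0.2), hG.2.2.2 z hz g0 hg0, L (z h), ⟨_, rfl⟩, ?_⟩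
        have e1 : z (y h) = y (z h) := congrArg (fun L : H →L[ℂ] H => L h) c1.eq
        have e3 : z (CFC.abs y h) = CFC.abs y (z h) :=
          congrArg (fun L : H →L[ℂ] H => L h) c3.eq
        simp only [map_add, e1, e3]
        rfl
    have hle : G ⊔ LinearMap.range L ≤ G := hmax hL le_sup_left
    ext h
    have hmem : L h ∈ G := hle (Submodule.mem_sup_right ⟨h, rfl⟩)
    have := hq1G _ hmem
    have h2 : (q - Q) (y h) = y h := congrArg (fun L : H →L[ℂ] H => L h) hqy
    rw [← h2]
    exact this
  rcases factor_mul_eq_zero M hM _ _ hq1M key with h0 | h0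
  · left
    exact hG.subordinate (sub_eq_zero.1 h0).symm
  · right
    exact hG'.subordinate (sub_eq_zero.1 h0).symm

/-- Totality forces central projections to be trivial. -/
theorem central_proj_trivial (M : VonNeumannAlgebra H)
    (hM : ∀ p q : H →L[ℂ] H, p ∈ M → q ∈ M → IsProjection p → IsProjection q →
      Subordinate M p q ∨ Subordinate M q p)
    (z : H →L[ℂ] H) (hz : z ∈ M) (hzc : ∀ S ∈ M, z * S = S * z) (hzp : IsStarProjection z) :
    z = 0 ∨ z = 1 := by
  have gen : ∀ e : H →L[ℂ] H, (∀ S ∈ M, e * S = S * e) → e * e = e →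
      Subordinate M e (1 - e) → e = 0 := by
    rintro e hec hee ⟨p', hp'M, hp', hle, u, hu, h1, h2⟩
    have hep : e * p' = 0 := by
      rw [sub_mul, one_mul, sub_eq_self] at hle
      exact hle
    have hus : ContinuousLinearMap.adjoint u ∈ M := star_mem hu
    have hx : e * e * e = 0 := by
      calc e * e * e = e * (ContinuousLinearMap.adjoint u * u)
            * (ContinuousLinearMap.adjoint u * u) := by rw [h1]
        _ = (e * ContinuousLinearMap.adjoint u) * (u * ContinuousLinearMap.adjoint u) * u := by
          simp only [mul_assoc]
        _ = 0 := by rw [hec _ hus, h2, mul_assoc (ContinuousLinearMap.adjoint u), hep]; simp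
    rwa [hee, hee] at hx
  have hz1 : IsStarProjection (1 - z) := hzp.one_sub
  have hee : z * z = z := hzp.isIdempotentElem
  have hee1 : (1 - z) * (1 - z) = 1 - z := hz1.isIdempotentElem
  rcases hM z (1 - z) hz (sub_mem (one_mem M) hz) ⟨hzp.isIdempotentElem, hzp.isSelfAdjoint⟩
    ⟨hz1.isIdempotentElem, hz1.isSelfAdjoint⟩ with h | h
  · left; exact gen z hzc hee h
  · right
    have := gen (1 - z) (fun S hS => by rw [sub_mul, mul_sub, hzc S hS, one_mul, mul_one]) hee1
      (by rwa [sub_sub_cancel])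
    exact (sub_eq_zero.1 this).symm

theorem total_factor (M : VonNeumannAlgebra H)
    (hM : ∀ p q : H →L[ℂ] H, p ∈ M → q ∈ M → IsProjection p → IsProjection q →
      Subordinate M p q ∨ Subordinate M q p)
    (T : H →L[ℂ] H) (hT : T ∈ M) (hTc : ∀ S ∈ M, T * S = S * T) :
    ∃ c : ℂ, T = c • (1 : H →L[ℂ] H) := by
  have hsT : star T ∈ M := star_mem hT
  have hsTc : ∀ S ∈ M, star T * S = S * star T := by
    intro S hS
    have := congrArg star (hTc (star S) (star_mem hS))
    simpa [star_mul] using this.symm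
  haveI hN : IsStarNormal T := ⟨(hTc _ hsT).symm⟩
  -- products
  have prod : ∀ f g : ℂ → ℂ, cfc f T * cfc g T = 0 → cfc f T = 0 ∨ cfc g T = 0 := by
    intro f g hfg
    let A := cfc f T
    have hA1 : ∀ S ∈ M, Commute A S := fun S hS =>
      Commute.cfc (hTc S hS) (hsTc S hS) f
    have hA2 : ∀ S ∈ M.commutant, Commute A S := fun S hS =>
      Commute.cfc (VonNeumannAlgebra.mem_commutant_iff.1 hS T hT)
        (VonNeumannAlgebra.mem_commutant_iff.1 hS _ hsT) f
    let K : Submodule ℂ H := A.ker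
    have hcl : IsClosed (K : Set H) := A.isClosed_ker
    haveI : CompleteSpace K := hcl.completeSpace_coe
    have inv : ∀ S, Commute A S → ∀ x ∈ K, S x ∈ K := by
      intro S hS x hx
      have h1 : A (S x) = S (A x) := congrArg (fun L : H →L[ℂ] H => L x) hS.eq
      have h2 : A x = 0 := hx
      show A (S x) = 0
      rw [h1, h2, map_zero]
    have a1 := starProjection_mem M K fun y hy => inv y (hA2 y hy)
    have a2 := starProjection_mem M.commutant K fun y hy => inv y
      (hA1 y (by rwa [VonNeumannAlgebra.commutant_commutant] at hy))
    rw [VonNeumannAlgebra.mem_commutant_iff] at a2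
    rcases central_proj_trivial M hM _ a1 (fun S hS => (a2 S hS).symm)
      isStarProjection_starProjection with h0 | h0
    · right
      ext x
      have hx : cfc g T x ∈ K := congrArg (fun L : H →L[ℂ] H => L x) hfg
      rw [← Submodule.starProjection_eq_self_iff.2 hx, h0]
      simp
    · left
      ext x
      have hx : x ∈ K := Submodule.starProjection_eq_self_iff.1 (by rw [h0]; rfl)
      exact hx
  have bump : ∀ a ∈ spectrum ℂ T, ∀ r > 0,
      cfc (fun z : ℂ => ((max 0 (r - ‖z - a‖) : ℝ) : ℂ)) T ≠ 0 := by
    intro a ha r hr h0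
    have hc : ContinuousOn (fun z : ℂ => ((max 0 (r - ‖z - a‖) : ℝ) : ℂ)) (spectrum ℂ T) := by
      fun_prop
    have h1 := cfc_map_spectrum (fun z : ℂ => ((max 0 (r - ‖z - a‖) : ℝ) : ℂ)) T
    have h2 : ((max 0 (r - ‖a - a‖) : ℝ) : ℂ) ∈
        spectrum ℂ (cfc (fun z : ℂ => ((max 0 (r - ‖z - a‖) : ℝ) : ℂ)) T) := by
      rw [h1]; exact ⟨a, ha, rfl⟩
    rw [h0] at h2
    have hr' : ((max 0 (r - ‖a - a‖) : ℝ) : ℂ) = (r : ℂ) := by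
      simp [hr.le]
    rw [hr'] at h2
    have hr0 : (r : ℂ) ≠ 0 := by exact_mod_cast hr.ne'
    apply h2
    show IsUnit (algebraMap ℂ (H →L[ℂ] H) r - 0)
    rw [sub_zero]
    exact (IsUnit.mk0 _ hr0).map _
  have hsub : ∀ a ∈ spectrum ℂ T, ∀ b ∈ spectrum ℂ T, a = b := by
    intro a ha b hb
    by_contra hab
    have hr : 0 < ‖a - b‖ / 2 := by
      have := norm_pos_iff.2 (sub_ne_zero.2 hab)
      positivity
    have := prod (fun z : ℂ => ((max 0 (‖a - b‖ / 2 - ‖z - a‖) : ℝ) : ℂ))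
      (fun z : ℂ => ((max 0 (‖a - b‖ / 2 - ‖z - b‖) : ℝ) : ℂ)) ?_
    · rcases this with h | h
      · exact bump a ha _ hr h
      · exact bump b hb _ hr h
    · rw [← cfc_mul _ _ T (by fun_prop) (by fun_prop)]
      have hz : (fun z : ℂ => ((max 0 (‖a - b‖ / 2 - ‖z - a‖) : ℝ) : ℂ) *
          ((max 0 (‖a - b‖ / 2 - ‖z - b‖) : ℝ) : ℂ)) = fun _ => 0 := by
        funext z
        have htri : ‖a - b‖ ≤ ‖z - a‖ + ‖z - b‖ := by
          rw [norm_sub_rev z a]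
          simpa using norm_add_le (a - z) (z - b)
        rcases le_total (‖a - b‖ / 2) ‖z - a‖ with h | h
        · rw [max_eq_left (by linarith)]; simp
        · rw [max_eq_left (a := 0) (b := ‖a - b‖ / 2 - ‖z - b‖) (by linarith)]; simp
      rw [hz]
      exact cfc_const_zero ℂ T
  rcases Set.eq_empty_or_nonempty (spectrum ℂ T) with h | ⟨a, ha⟩
  · refine ⟨0, ?_⟩
    rw [← cfc_id ℂ T, cfc_congr (g := fun _ => (0 : ℂ)) (by rw [h]; intro x hx; exact hx.elim)]
    rw [cfc_const_zero]; simp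
  · refine ⟨a, ?_⟩
    have h1 : cfc (id : ℂ → ℂ) T = cfc (fun _ => a) T :=
      cfc_congr fun x hx => hsub x hx a ha
    rw [cfc_id ℂ T, cfc_const a T, Algebra.algebraMap_eq_smul_one] at h1
    exact h1

/-- A von Neumann algebra `M` is a factor (its center `M ∩ M'` consists of scalar multiples
of the identity) iff `≼` is total on the projections of `M`. -/
theorem factor_iff_subordinate_total (M : VonNeumannAlgebra H) :
    (∀ T ∈ M, (∀ S ∈ M, T * S = S * T) → ∃ c : ℂ, T = c • (1 : H →L[ℂ] H)) ↔
    (∀ p q : H →L[ℂ] H, p ∈ M → q ∈ M → IsProjection p → IsProjection q →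
      Subordinate M p q ∨ Subordinate M q p) := by
  exact ⟨fun h p q hp hq hpp hqp => comparison M h p q hp hq hpp hqp, fun h T => total_factor M h T⟩
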